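/- Let E be any directed graph and K any field. Then L_K(E) is a prime ring (i.e., for any two-sided ideals I, J of L_K(E), IJ = {0} implies I = {0} or J = {0}) if and only if E is downward directed. -/

import Mathlib

set_option synthInstance.maxHeartbeats 1000000
set_option maxHeartbeats 1000000

/-- Generators of the Leavitt path algebra: vertices, edges, and ghost edges. -/
inductive LPAGen (V E : Type) : Type
  | vertex : V → LPAGen V E
  | edge : E → LPAGen V E
  | ghost : E → LPAGen V E

/-- The defining relations of the Leavitt path algebra of the graph with vertex set `V`,
edge set `E`, and source and range maps `s r : E → V`.  The (CK2) relation is imposed at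
every regular vertex, i.e. every vertex emitting finitely many but at least one edge. -/
inductive LPARel (K : Type) [Field K] {V E : Type} (s r : E → V) :
    FreeAlgebra K (LPAGen V E) → FreeAlgebra K (LPAGen V E) → Prop
  | vertex_self (v : V) :
      LPARel K s r (FreeAlgebra.ι K (LPAGen.vertex v) * FreeAlgebra.ι K (LPAGen.vertex v))
        (FreeAlgebra.ι K (LPAGen.vertex v))
  | vertex_ne {v w : V} (h : v ≠ w) :
      LPARel K s r (FreeAlgebra.ι K (LPAGen.vertex v) * FreeAlgebra.ι K (LPAGen.vertex w)) 0
  | edge_left (e : E) :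
      LPARel K s r (FreeAlgebra.ι K (LPAGen.vertex (s e)) * FreeAlgebra.ι K (LPAGen.edge e))
        (FreeAlgebra.ι K (LPAGen.edge e))
  | edge_right (e : E) :
      LPARel K s r (FreeAlgebra.ι K (LPAGen.edge e) * FreeAlgebra.ι K (LPAGen.vertex (r e)))
        (FreeAlgebra.ι K (LPAGen.edge e))
  | ghost_left (e : E) :
      LPARel K s r (FreeAlgebra.ι K (LPAGen.vertex (r e)) * FreeAlgebra.ι K (LPAGen.ghost e))
        (FreeAlgebra.ι K (LPAGen.ghost e))
  | ghost_right (e : E) :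
      LPARel K s r (FreeAlgebra.ι K (LPAGen.ghost e) * FreeAlgebra.ι K (LPAGen.vertex (s e)))
        (FreeAlgebra.ι K (LPAGen.ghost e))
  | ck1_self (e : E) :
      LPARel K s r (FreeAlgebra.ι K (LPAGen.ghost e) * FreeAlgebra.ι K (LPAGen.edge e))
        (FreeAlgebra.ι K (LPAGen.vertex (r e)))
  | ck1_ne {e f : E} (h : e ≠ f) :
      LPARel K s r (FreeAlgebra.ι K (LPAGen.ghost e) * FreeAlgebra.ι K (LPAGen.edge f)) 0
  | ck2 (v : V) (h : {e : E | s e = v}.Finite) (hne : {e : E | s e = v}.Nonempty) :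
      LPARel K s r (FreeAlgebra.ι K (LPAGen.vertex v))
        (h.toFinset.sum fun e => FreeAlgebra.ι K (LPAGen.edge e) * FreeAlgebra.ι K (LPAGen.ghost e))

/-- The unital algebra presented by the Leavitt path algebra generators and relations
(for a graph with possibly infinitely many vertices this is the unitalization of the
Leavitt path algebra; the honest Leavitt path algebra is the non-unital subalgebra `lpa`
generated by the generators, defined below). -/
abbrev LPAU (K : Type) [Field K] {V E : Type} (s r : E → V) : Type :=
  RingQuot (LPARel K s r)

variable (K : Type) [Field K] {V E : Type} (s r : E → V)

/-- The canonical image of a generator. -/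
def gen (g : LPAGen V E) : LPAU K s r :=
  RingQuot.mkAlgHom K (LPARel K s r) (FreeAlgebra.ι K g)

def vertexEl (v : V) : LPAU K s r := gen K s r (LPAGen.vertex v)
def edgeEl (e : E) : LPAU K s r := gen K s r (LPAGen.edge e)
def ghostEl (e : E) : LPAU K s r := gen K s r (LPAGen.ghost e)

/-- The Leavitt path algebra `L_K(E)` of an arbitrary graph, realized (honestly, i.e.
without an adjoined unit) as the non-unital subalgebra generated by the vertices, edges
and ghost edges. -/
def lpa : NonUnitalSubalgebra K (LPAU K s r) :=
  NonUnitalAlgebra.adjoin K (Set.range (gen K s r))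

def vertexIn (v : V) : ↥(lpa K s r) :=
  ⟨vertexEl K s r v, NonUnitalAlgebra.subset_adjoin K (Set.mem_range_self _)⟩

def edgeIn (e : E) : ↥(lpa K s r) :=
  ⟨edgeEl K s r e, NonUnitalAlgebra.subset_adjoin K (Set.mem_range_self _)⟩

def ghostIn (e : E) : ↥(lpa K s r) :=
  ⟨ghostEl K s r e, NonUnitalAlgebra.subset_adjoin K (Set.mem_range_self _)⟩

instance lpaNonUnitalRing : NonUnitalRing ↥(lpa K s r) := inferInstance
instance lpaAddCommGroup : AddCommGroup ↥(lpa K s r) := inferInstance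
instance lpaModule : Module K ↥(lpa K s r) := inferInstance

/-- Paths in a directed graph: `IsPathFrom s r v w es` means the list of edges `es` is a
directed path from `v` to `w` (each vertex is a path of length `0`). -/
inductive IsPathFrom {V E : Type} (s r : E → V) : V → V → List E → Prop
  | nil (v : V) : IsPathFrom s r v v []
  | cons (e : E) {w : V} {es : List E} :
      IsPathFrom s r (r e) w es → IsPathFrom s r (s e) w (e :: es)

/-- `v ≥ w` : there is a path from `v` to `w`. -/
def Geq {V E : Type} (s r : E → V) (v w : V) : Prop :=
  ∃ es : List E, IsPathFrom s r v w es

/-- A cycle based at `v` : a nonempty closed path whose source vertices are pairwise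
distinct. -/
def IsCycle {V E : Type} (s r : E → V) (v : V) (es : List E) : Prop :=
  es ≠ [] ∧ IsPathFrom s r v v es ∧ (es.map s).Nodup

/-- A path (given by its list of edges) has an exit. -/
def HasExit {V E : Type} (s : E → V) (es : List E) : Prop :=
  ∃ f : E, ∃ e ∈ es, s f = s e ∧ f ≠ e

/-- A set of vertices is hereditary. -/
def Hereditary {V E : Type} (s r : E → V) (X : Set V) : Prop :=
  ∀ v ∈ X, ∀ w : V, Geq s r v w → w ∈ X

/-- A set of vertices is saturated. -/
def Saturated {V E : Type} (s r : E → V) (X : Set V) : Prop :=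
  ∀ v : V, {e : E | s e = v}.Finite → {e : E | s e = v}.Nonempty →
    (∀ e : E, s e = v → r e ∈ X) → v ∈ X

/-- A subset of a (possibly non-unital) ring is a two-sided ideal. -/
def IsTwoSidedIdealSet {R : Type} [Zero R] [Add R] [Neg R] [Mul R] (I : Set R) : Prop :=
  (0 : R) ∈ I ∧ (∀ a ∈ I, ∀ b ∈ I, a + b ∈ I) ∧ (∀ a ∈ I, -a ∈ I) ∧
    ∀ x : R, ∀ a ∈ I, x * a ∈ I ∧ a * x ∈ I

section Relations

theorem vertexEl_mul_self (v : V) :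
    vertexEl K s r v * vertexEl K s r v = vertexEl K s r v := by
  simpa [vertexEl, gen] using
    RingQuot.mkAlgHom_rel K (LPARel.vertex_self (K := K) (s := s) (r := r) v)

theorem vertexEl_mul_of_ne {v w : V} (h : v ≠ w) :
    vertexEl K s r v * vertexEl K s r w = 0 := by
  simpa [vertexEl, gen] using
    RingQuot.mkAlgHom_rel K (LPARel.vertex_ne (K := K) (s := s) (r := r) h)

theorem source_mul_edgeEl (e : E) :
    vertexEl K s r (s e) * edgeEl K s r e = edgeEl K s r e := by
  simpa [vertexEl, edgeEl, gen] using
    RingQuot.mkAlgHom_rel K (LPARel.edge_left (K := K) (s := s) (r := r) e)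

theorem edgeEl_mul_range (e : E) :
    edgeEl K s r e * vertexEl K s r (r e) = edgeEl K s r e := by
  simpa [vertexEl, edgeEl, gen] using
    RingQuot.mkAlgHom_rel K (LPARel.edge_right (K := K) (s := s) (r := r) e)

theorem range_mul_ghostEl (e : E) :
    vertexEl K s r (r e) * ghostEl K s r e = ghostEl K s r e := by
  simpa [vertexEl, ghostEl, gen] using
    RingQuot.mkAlgHom_rel K (LPARel.ghost_left (K := K) (s := s) (r := r) e)

theorem ghostEl_mul_source (e : E) :
    ghostEl K s r e * vertexEl K s r (s e) = ghostEl K s r e := by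
  simpa [vertexEl, ghostEl, gen] using
    RingQuot.mkAlgHom_rel K (LPARel.ghost_right (K := K) (s := s) (r := r) e)

theorem ghostEl_mul_edgeEl_self (e : E) :
    ghostEl K s r e * edgeEl K s r e = vertexEl K s r (r e) := by
  simpa [vertexEl, edgeEl, ghostEl, gen] using
    RingQuot.mkAlgHom_rel K (LPARel.ck1_self (K := K) (s := s) (r := r) e)

theorem ghostEl_mul_edgeEl_of_ne {e f : E} (h : e ≠ f) :
    ghostEl K s r e * edgeEl K s r f = 0 := by
  simpa [edgeEl, ghostEl, gen] using
    RingQuot.mkAlgHom_rel K (LPARel.ck1_ne (K := K) (s := s) (r := r) h)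

theorem vertexEl_eq_sum (v : V) (h : {e : E | s e = v}.Finite)
    (hne : {e : E | s e = v}.Nonempty) :
    vertexEl K s r v = ∑ e ∈ h.toFinset, edgeEl K s r e * ghostEl K s r e := by
  simpa [vertexEl, edgeEl, ghostEl, gen] using
    RingQuot.mkAlgHom_rel K (LPARel.ck2 (K := K) (s := s) (r := r) v h hne)

theorem vertexEl_mul_edgeEl_of_ne {v : V} {e : E} (h : v ≠ s e) :
    vertexEl K s r v * edgeEl K s r e = 0 := by
  rw [← source_mul_edgeEl, ← mul_assoc, vertexEl_mul_of_ne K s r h, zero_mul]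

theorem ghostEl_mul_vertexEl_of_ne {v : V} {e : E} (h : s e ≠ v) :
    ghostEl K s r e * vertexEl K s r v = 0 := by
  rw [← ghostEl_mul_source, mul_assoc, vertexEl_mul_of_ne K s r h, mul_zero]

end Relations

section Representation

/-- A branching system on `E ⊕ ℕ`: for each vertex that is not a
sink, the maps `enc e` with `s e = v` decompose `E ⊕ ℕ` into disjoint copies of itself. -/
theorem exists_edge_encoding : ∃ enc : E → E ⊕ ℕ → E ⊕ ℕ,
    (∀ e e' b b', s e = s e' → enc e b = enc e' b' → e = e' ∧ b = b') ∧
      ∀ e₀ c, ∃ e b, s e = s e₀ ∧ enc e b = c := by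
  have key (e₀ : E) : Nonempty ({e // s e = s e₀} × (E ⊕ ℕ) ≃ (E ⊕ ℕ)) := by
    rw [← Cardinal.eq, Cardinal.mk_prod, Cardinal.lift_id, Cardinal.lift_id]
    refine Cardinal.mul_eq_right (Cardinal.aleph0_le_mk _) ?_ ?_
    · exact Cardinal.mk_le_of_injective (f := fun e => Sum.inl e.1)
        fun a b h => Subtype.ext (Sum.inl_injective h)
    · exact (Cardinal.mk_ne_zero_iff).2 ⟨⟨e₀, rfl⟩⟩
  have key' (v : V) : ∃ ψ : {e // s e = v} × (E ⊕ ℕ) → (E ⊕ ℕ), Function.Injective ψ ∧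
      (Nonempty {e // s e = v} → Function.Surjective ψ) := by
    by_cases h : Nonempty {e // s e = v}
    · obtain ⟨e₀, rfl⟩ := h
      obtain ⟨φ⟩ := key e₀
      exact ⟨φ, φ.injective, fun _ => φ.surjective⟩
    · exact ⟨fun x => x.2, fun x => (h ⟨x.1⟩).elim, fun h' => (h h').elim⟩
  choose ψ hinj hsurj using key'
  refine ⟨fun e b => ψ (s e) (⟨e, rfl⟩, b), fun e e' b b' hs h => ?_, fun e₀ c => ?_⟩
  · have aux : ∀ (v : V) (he : s e = v), ψ v (⟨e, he⟩, b) = ψ (s e) (⟨e, rfl⟩, b) := by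
      rintro _ rfl; rfl
    dsimp only at h
    rw [← aux _ hs] at h
    have := hinj _ h
    simpa using this
  · obtain ⟨⟨⟨e, he⟩, b⟩, h⟩ := hsurj (s e₀) ⟨⟨e₀, rfl⟩⟩ c
    refine ⟨e, b, he, ?_⟩
    have aux : ∀ (v : V) (he : s e = v), ψ v (⟨e, he⟩, b) = ψ (s e) (⟨e, rfl⟩, b) := by
      rintro _ rfl; rfl
    exact (aux _ he).symm.trans h

open Classical in
/-- A graded representation of the algebra on functions on `V × (E ⊕ ℕ) × ℤ`: vertices act by
restriction and edges raise the degree filtration by one. -/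
theorem exists_graded_representation : ∃ ρ : LPAU K s r →ₐ[K] Module.End K (V × (E ⊕ ℕ) × ℤ → K),
    (∀ v f x, ρ (vertexEl K s r v) f x = if x.1 = v then f x else 0) ∧
      ∀ e f (m : ℤ), (∀ x, x.2.2 < m → f x = 0) →
        ∀ x, x.2.2 < m + 1 → ρ (edgeEl K s r e) f x = 0 := by
  obtain ⟨enc, hinj, hsurj⟩ := exists_edge_encoding s
  let emb (e : E) (y : (E ⊕ ℕ) × ℤ) : V × (E ⊕ ℕ) × ℤ := (s e, enc e y.1, y.2 + 1)
  have emb_inj {e e' y y'} (h : emb e y = emb e' y') : e = e' ∧ y = y' := by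
    simp only [emb, Prod.mk.injEq, add_left_inj] at h
    obtain ⟨h1, h2⟩ := hinj _ _ _ _ h.1 h.2.1
    exact ⟨h1, Prod.ext h2 h.2.2⟩
  have emb_injective (e : E) : Function.Injective (emb e) := fun _ _ h => (emb_inj h).2
  have emb_surj (e₀ : E) (x : V × (E ⊕ ℕ) × ℤ) (hx : x.1 = s e₀) :
      ∃ e y, s e = s e₀ ∧ emb e y = x := by
    obtain ⟨e, b, he, hb⟩ := hsurj e₀ x.2.1
    refine ⟨e, (b, x.2.2 - 1), he, ?_⟩
    ext <;> simp [emb, *]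
  let vop (v : V) : Module.End K (V × (E ⊕ ℕ) × ℤ → K) :=
    { toFun := fun f x => if x.1 = v then f x else 0
      map_add' := fun f g => by ext x; by_cases h : x.1 = v <;> simp [h]
      map_smul' := fun k f => by ext x; by_cases h : x.1 = v <;> simp [h] }
  let eop (e : E) : Module.End K (V × (E ⊕ ℕ) × ℤ → K) :=
    { toFun := fun f => Function.extend (emb e) (fun y => f (r e, y)) 0
      map_add' := fun f g => by
        ext x
        by_cases h : ∃ y, emb e y = x
        · obtain ⟨y, rfl⟩ := h
          simp [(emb_injective e).extend_apply]
        · simp [Function.extend_apply' _ _ _ h]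
      map_smul' := fun k f => by
        ext x
        by_cases h : ∃ y, emb e y = x
        · obtain ⟨y, rfl⟩ := h
          simp [(emb_injective e).extend_apply]
        · simp [Function.extend_apply' _ _ _ h] }
  let gop (e : E) : Module.End K (V × (E ⊕ ℕ) × ℤ → K) :=
    { toFun := fun f x => if x.1 = r e then f (emb e x.2) else 0
      map_add' := fun f g => by ext x; by_cases h : x.1 = r e <;> simp [h]
      map_smul' := fun k f => by ext x; by_cases h : x.1 = r e <;> simp [h] }
  have vop_apply (v f x) : vop v f x = if x.1 = v then f x else 0 := rfl
  have gop_apply (e f x) : gop e f x = if x.1 = r e then f (emb e x.2) else 0 := rfl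
  have eop_emb (e f y) : eop e f (emb e y) = f (r e, y) :=
    (emb_injective e).extend_apply (fun y => f (r e, y)) 0 y
  have eop_of_ne (e f x) (h : ¬ ∃ y, emb e y = x) : eop e f x = 0 :=
    Function.extend_apply' (fun y => f (r e, y)) (0 : V × (E ⊕ ℕ) × ℤ → K) x h
  clear_value vop eop gop
  let act : LPAGen V E → Module.End K (V × (E ⊕ ℕ) × ℤ → K)
    | .vertex v => vop v
    | .edge e => eop e
    | .ghost e => gop e
  have hrel : ∀ ⦃x y⦄, LPARel K s r x y → FreeAlgebra.lift K act x = FreeAlgebra.lift K act y := by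
    intro x y h
    induction h with
    | vertex_self v =>
      ext f x
      simp only [act, map_mul, FreeAlgebra.lift_ι_apply, Module.End.mul_apply, vop_apply]
      split_ifs <;> rfl
    | vertex_ne h =>
      ext f x
      simp only [act, map_mul, map_zero, FreeAlgebra.lift_ι_apply, Module.End.mul_apply,
        vop_apply, LinearMap.zero_apply, Pi.zero_apply]
      grind
    | edge_left e =>
      ext f x
      simp only [act, map_mul, FreeAlgebra.lift_ι_apply, Module.End.mul_apply, vop_apply]
      split_ifs with h
      · rfl
      · rw [eop_of_ne]
        rintro ⟨y, rfl⟩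
        exact h rfl
    | edge_right e =>
      ext f x
      simp only [act, map_mul, FreeAlgebra.lift_ι_apply, Module.End.mul_apply]
      by_cases h : ∃ y, emb e y = x
      · obtain ⟨y, rfl⟩ := h
        simp [eop_emb, vop_apply]
      · rw [eop_of_ne _ _ _ h, eop_of_ne _ _ _ h]
    | ghost_left e =>
      ext f x
      simp only [act, map_mul, FreeAlgebra.lift_ι_apply, Module.End.mul_apply, vop_apply,
        gop_apply]
      grind
    | ghost_right e =>
      ext f x
      simp only [act, map_mul, FreeAlgebra.lift_ι_apply, Module.End.mul_apply, vop_apply,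
        gop_apply]
      simp [emb]
    | ck1_self e =>
      ext f ⟨x, y⟩
      simp only [act, map_mul, FreeAlgebra.lift_ι_apply, Module.End.mul_apply, vop_apply,
        gop_apply, eop_emb]
      grind
    | @ck1_ne e e' h =>
      ext f x
      simp only [act, map_mul, FreeAlgebra.lift_ι_apply, Module.End.mul_apply, gop_apply]
      rw [eop_of_ne]
      · simp
      · rintro ⟨y, hy⟩
        exact h (emb_inj hy).1.symm
    | ck2 v h hne =>
      ext f x
      simp only [act, map_sum, map_mul, FreeAlgebra.lift_ι_apply, LinearMap.sum_apply,
        Finset.sum_apply, Module.End.mul_apply, vop_apply]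
      obtain ⟨e₀, rfl⟩ := hne
      split_ifs with hx
      · obtain ⟨e, y, he, rfl⟩ := emb_surj e₀ x hx
        rw [Finset.sum_eq_single e]
        · simp [eop_emb, gop_apply]
        · intro e' _ hne
          apply eop_of_ne
          rintro ⟨y', hy'⟩
          exact hne (emb_inj hy').1
        · intro hmem
          simp [he] at hmem
      · refine (Finset.sum_eq_zero fun e he => eop_of_ne _ _ _ ?_).symm
        rintro ⟨y, rfl⟩
        exact hx (by simpa using he)
  refine ⟨RingQuot.liftAlgHom K ⟨FreeAlgebra.lift K act, hrel⟩, fun v f x => ?_,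
    fun e f m hf x hx => ?_⟩
  · simp [vertexEl, gen, act, vop_apply]
  · simp only [edgeEl, gen, RingQuot.liftAlgHom_mkAlgHom_apply, FreeAlgebra.lift_ι_apply, act]
    by_cases h : ∃ y, emb e y = x
    · obtain ⟨y, rfl⟩ := h
      rw [eop_emb]
      exact hf _ (by simpa [emb] using hx)
    · exact eop_of_ne _ _ _ h

end Representation

section Paths

/-- The product of the edges in a list. -/
def pathEl (p : List E) : LPAU K s r := (p.map (edgeEl K s r)).prod

/-- The product of the ghost edges in a list, in reverse order. -/
def ghostPathEl (q : List E) : LPAU K s r := (q.reverse.map (ghostEl K s r)).prod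

@[simp] theorem pathEl_nil : pathEl K s r [] = 1 := rfl

@[simp] theorem ghostPathEl_nil : ghostPathEl K s r [] = 1 := rfl

theorem pathEl_cons (e : E) (p : List E) :
    pathEl K s r (e :: p) = edgeEl K s r e * pathEl K s r p := by simp [pathEl]

theorem pathEl_concat (e : E) (p : List E) :
    pathEl K s r (p ++ [e]) = pathEl K s r p * edgeEl K s r e := by simp [pathEl]

theorem ghostPathEl_cons (e : E) (q : List E) :
    ghostPathEl K s r (e :: q) = ghostPathEl K s r q * ghostEl K s r e := by simp [ghostPathEl]

theorem ghostPathEl_concat (e : E) (q : List E) :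
    ghostPathEl K s r (q ++ [e]) = ghostEl K s r e * ghostPathEl K s r q := by simp [ghostPathEl]

theorem vertexEl_mul_pathEl_mul (w : V) (p : List E) (u : V) :
    vertexEl K s r w * (pathEl K s r p * vertexEl K s r u) = pathEl K s r p * vertexEl K s r u ∨
      vertexEl K s r w * (pathEl K s r p * vertexEl K s r u) = 0 := by
  cases p with
  | nil =>
    by_cases h : w = u
    · subst h; simp [vertexEl_mul_self]
    · simp [vertexEl_mul_of_ne K s r h]
  | cons e p =>
    by_cases h : w = s e
    · subst h; left; rw [pathEl_cons, ← mul_assoc, ← mul_assoc, source_mul_edgeEl]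
    · right; simp [pathEl_cons, ← mul_assoc, vertexEl_mul_edgeEl_of_ne K s r h]

theorem mul_ghostPathEl_mul_vertexEl (u : V) (q : List E) (w : V) :
    vertexEl K s r u * ghostPathEl K s r q * vertexEl K s r w =
        vertexEl K s r u * ghostPathEl K s r q ∨
      vertexEl K s r u * ghostPathEl K s r q * vertexEl K s r w = 0 := by
  cases q with
  | nil =>
    by_cases h : u = w
    · subst h; simp [vertexEl_mul_self]
    · simp [vertexEl_mul_of_ne K s r h]
  | cons e q =>
    by_cases h : s e = w
    · subst h; left; simp only [ghostPathEl_cons, mul_assoc, ghostEl_mul_source]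
    · right; simp [ghostPathEl_cons, mul_assoc, ghostEl_mul_vertexEl_of_ne K s r h]

theorem geq_of_vertexEl_mul_pathEl_ne_zero {p : List E} {u : V} : ∀ {v : V},
    vertexEl K s r v * (pathEl K s r p * vertexEl K s r u) ≠ 0 → Geq s r v u := by
  induction p with
  | nil =>
    intro v h
    by_cases hv : v = u
    · subst hv; exact ⟨[], .nil v⟩
    · simp [vertexEl_mul_of_ne K s r hv] at h
  | cons e p ih =>
    intro v h
    by_cases hv : v = s e
    · subst hv
      obtain ⟨es, hes⟩ := @ih (r e) fun h0 => h <| by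
        rw [pathEl_cons, ← edgeEl_mul_range]
        simp only [mul_assoc]
        rw [h0, mul_zero, mul_zero]
      exact ⟨e :: es, .cons e hes⟩
    · simp [pathEl_cons, ← mul_assoc, vertexEl_mul_edgeEl_of_ne K s r hv] at h

theorem geq_of_ghostPathEl_mul_vertexEl_ne_zero {q : List E} {u : V} : ∀ {v : V},
    vertexEl K s r u * ghostPathEl K s r q * vertexEl K s r v ≠ 0 → Geq s r v u := by
  induction q with
  | nil =>
    intro v h
    by_cases hv : u = v
    · subst hv; exact ⟨[], .nil u⟩
    · simp [vertexEl_mul_of_ne K s r hv] at h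
  | cons e q ih =>
    intro v h
    by_cases hv : s e = v
    · subst hv
      obtain ⟨es, hes⟩ := @ih (r e) fun h0 => h <| by
        rw [ghostPathEl_cons, ← range_mul_ghostEl]
        simp only [← mul_assoc]
        rw [h0, zero_mul, zero_mul]
      exact ⟨e :: es, .cons e hes⟩
    · simp [ghostPathEl_cons, mul_assoc, ghostEl_mul_vertexEl_of_ne K s r hv] at h

end Paths

section Span

/-- The span of the monomials `p u q*`, where the list of ghost edges `q` has length at
most `n`. -/
def ghostBounded (n : ℕ) : Submodule K (LPAU K s r) :=
  Submodule.span K {x | ∃ p u q, q.length ≤ n ∧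
    x = pathEl K s r p * vertexEl K s r u * ghostPathEl K s r q}

theorem monomial_mem_ghostBounded (p : List E) (u : V) {q : List E} {n : ℕ} (h : q.length ≤ n) :
    pathEl K s r p * vertexEl K s r u * ghostPathEl K s r q ∈ ghostBounded K s r n :=
  Submodule.subset_span ⟨p, u, q, h, rfl⟩

theorem ghostBounded_mono {m n : ℕ} (h : m ≤ n) : ghostBounded K s r m ≤ ghostBounded K s r n := by
  refine Submodule.span_mono ?_
  rintro _ ⟨p, u, q, hq, rfl⟩
  exact ⟨p, u, q, hq.trans h, rfl⟩

/-- The span of all monomials `p u q*`. -/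
def monomialSpan : Submodule K (LPAU K s r) :=
  Submodule.span K {x | ∃ p u q, x = pathEl K s r p * vertexEl K s r u * ghostPathEl K s r q}

theorem monomial_mem_monomialSpan (p : List E) (u : V) (q : List E) :
    pathEl K s r p * vertexEl K s r u * ghostPathEl K s r q ∈ monomialSpan K s r :=
  Submodule.subset_span ⟨p, u, q, rfl⟩

theorem exists_mem_ghostBounded {x : LPAU K s r} (hx : x ∈ monomialSpan K s r) :
    ∃ n, x ∈ ghostBounded K s r n := by
  induction hx using Submodule.span_induction with
  | mem x h =>
    obtain ⟨p, u, q, rfl⟩ := h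
    exact ⟨_, monomial_mem_ghostBounded K s r p u le_rfl⟩
  | zero => exact ⟨0, zero_mem _⟩
  | add x y _ _ hx hy =>
    obtain ⟨m, hm⟩ := hx
    obtain ⟨n, hn⟩ := hy
    exact ⟨max m n, add_mem (ghostBounded_mono K s r (le_max_left _ _) hm)
      (ghostBounded_mono K s r (le_max_right _ _) hn)⟩
  | smul k x _ hx =>
    obtain ⟨m, hm⟩ := hx
    exact ⟨m, Submodule.smul_mem _ _ hm⟩

theorem vertexEl_mul_monomial_mem (w : V) (p : List E) (u : V) (q : List E) :
    vertexEl K s r w * (pathEl K s r p * vertexEl K s r u * ghostPathEl K s r q) ∈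
      monomialSpan K s r := by
  rw [← mul_assoc]
  rcases vertexEl_mul_pathEl_mul K s r w p u with h | h
  · rw [h]; exact monomial_mem_monomialSpan K s r p u q
  · rw [h, zero_mul]; exact zero_mem _

theorem gen_mul_monomial_mem (g : LPAGen V E) (p : List E) (u : V) (q : List E) :
    gen K s r g * (pathEl K s r p * vertexEl K s r u * ghostPathEl K s r q) ∈
      monomialSpan K s r := by
  cases g with
  | vertex w => exact vertexEl_mul_monomial_mem K s r w p u q
  | edge e =>
    have := monomial_mem_monomialSpan K s r (e :: p) u q
    rwa [pathEl_cons, mul_assoc, mul_assoc, ← mul_assoc (pathEl K s r p)] at this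
  | ghost e =>
    change ghostEl K s r e * _ ∈ _
    cases p with
    | nil =>
      by_cases h : s e = u
      · subst h
        have := monomial_mem_monomialSpan K s r [] (r e) (q ++ [e])
        rw [ghostPathEl_concat, mul_assoc, ← mul_assoc (vertexEl K s r _), range_mul_ghostEl] at this
        simpa [← mul_assoc, ghostEl_mul_source] using this
      · simp [← mul_assoc, ghostEl_mul_vertexEl_of_ne K s r h]
    | cons f p =>
      by_cases h : e = f
      · subst h
        have := vertexEl_mul_monomial_mem K s r (r e) p u q
        rw [← ghostEl_mul_edgeEl_self] at this
        simpa only [pathEl_cons, mul_assoc] using this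
      · simp [pathEl_cons, ← mul_assoc, ghostEl_mul_edgeEl_of_ne K s r h]

theorem lpa_le_monomialSpan {x : LPAU K s r} (hx : x ∈ lpa K s r) : x ∈ monomialSpan K s r := by
  suffices h : x ∈ monomialSpan K s r ∧ ∀ y ∈ monomialSpan K s r, x * y ∈ monomialSpan K s r from h.1
  induction hx using NonUnitalAlgebra.adjoin_induction with
  | mem x h =>
    obtain ⟨g, rfl⟩ := h
    refine ⟨?_, fun y hy => ?_⟩
    · cases g with
      | vertex v =>
        change vertexEl K s r v ∈ _
        simpa using monomial_mem_monomialSpan K s r [] v []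
      | edge e =>
        change edgeEl K s r e ∈ _
        simpa [pathEl_cons, edgeEl_mul_range] using monomial_mem_monomialSpan K s r [e] (r e) []
      | ghost e =>
        change ghostEl K s r e ∈ _
        simpa [ghostPathEl_cons, range_mul_ghostEl] using
          monomial_mem_monomialSpan K s r [] (r e) [e]
    · induction hy using Submodule.span_induction with
      | mem y h =>
        obtain ⟨p, u, q, rfl⟩ := h
        exact gen_mul_monomial_mem K s r g p u q
      | zero => simp
      | add y z _ _ hy hz => rw [mul_add]; exact add_mem hy hz
      | smul k y _ hy => rw [mul_smul_comm]; exact Submodule.smul_mem _ _ hy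
  | add x y _ _ hx hy =>
    exact ⟨add_mem hx.1 hy.1, fun z hz => by rw [add_mul]; exact add_mem (hx.2 z hz) (hy.2 z hz)⟩
  | zero => simp
  | mul x y _ _ hx hy =>
    exact ⟨hx.2 y hy.1, fun z hz => by rw [mul_assoc]; exact hx.2 _ (hy.2 z hz)⟩
  | smul k x _ hx =>
    exact ⟨Submodule.smul_mem _ _ hx.1, fun z hz => by
      rw [smul_mul_assoc]; exact Submodule.smul_mem _ _ (hx.2 z hz)⟩

theorem gen_mem_lpa (g : LPAGen V E) : gen K s r g ∈ lpa K s r :=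
  NonUnitalAlgebra.subset_adjoin K (Set.mem_range_self g)

theorem mul_mem_lpa (x : LPAU K s r) : ∀ {y : LPAU K s r}, y ∈ lpa K s r →
    x * y ∈ lpa K s r ∧ y * x ∈ lpa K s r := by
  obtain ⟨x, rfl⟩ := RingQuot.mkAlgHom_surjective K (LPARel K s r) x
  induction x using FreeAlgebra.induction with
  | grade0 k =>
    intro y hy
    simp only [AlgHom.commutes, ← Algebra.commutes k y, ← Algebra.smul_def, and_self]
    exact (lpa K s r).smul_mem' k hy
  | grade1 g =>
    intro y hy
    exact ⟨mul_mem (gen_mem_lpa K s r g) hy, mul_mem hy (gen_mem_lpa K s r g)⟩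
  | mul a b ha hb =>
    intro y hy
    rw [map_mul]
    refine ⟨?_, ?_⟩
    · rw [mul_assoc]; exact (ha (hb hy).1).1
    · rw [← mul_assoc]; exact (hb (ha hy).2).2
  | add a b ha hb =>
    intro y hy
    rw [map_add, add_mul, mul_add]
    exact ⟨add_mem (ha hy).1 (hb hy).1, add_mem (ha hy).2 (hb hy).2⟩

end Span

section Unipotent

/-- The span of the closed paths of positive length based at `u`. -/
def closedPathSpan (u : V) : Submodule K (LPAU K s r) :=
  Submodule.span K {x | ∃ p, p ≠ [] ∧
    x = vertexEl K s r u * (pathEl K s r p * vertexEl K s r u)}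

theorem vertexEl_mul_of_sub_mem {u : V} {x : LPAU K s r}
    (hx : x - vertexEl K s r u ∈ closedPathSpan K s r u) :
    vertexEl K s r u * x = x ∧ x * vertexEl K s r u = x := by
  have h : ∀ y ∈ closedPathSpan K s r u,
      vertexEl K s r u * y = y ∧ y * vertexEl K s r u = y := by
    intro y hy
    induction hy using Submodule.span_induction with
    | mem y h =>
      obtain ⟨p, -, rfl⟩ := h
      constructor
      · rw [← mul_assoc, vertexEl_mul_self]
      · simp only [mul_assoc, vertexEl_mul_self]
    | zero => simp
    | add y z _ _ hy hz => rw [mul_add, add_mul, hy.1, hy.2, hz.1, hz.2]; simp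
    | smul k y _ hy => rw [mul_smul_comm, smul_mul_assoc, hy.1, hy.2]; simp
  have := h _ hx
  simpa [mul_sub, sub_mul, vertexEl_mul_self] using this

theorem ghostEl_mul_mul_edgeEl_sub_mem (e : E) {x : LPAU K s r}
    (hx : x - vertexEl K s r (s e) ∈ closedPathSpan K s r (s e)) :
    ghostEl K s r e * x * edgeEl K s r e - vertexEl K s r (r e) ∈ closedPathSpan K s r (r e) := by
  have h : ∀ y ∈ closedPathSpan K s r (s e),
      ghostEl K s r e * y * edgeEl K s r e ∈ closedPathSpan K s r (r e) := by
    intro y hy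
    induction hy using Submodule.span_induction with
    | mem y h =>
      obtain ⟨p, hp, rfl⟩ := h
      rw [← mul_assoc, ghostEl_mul_source, mul_assoc, mul_assoc, source_mul_edgeEl]
      cases p with
      | nil => exact (hp rfl).elim
      | cons f p =>
        rw [pathEl_cons, ← mul_assoc, ← mul_assoc]
        by_cases hf : e = f
        · subst hf
          refine Submodule.subset_span ⟨p ++ [e], by simp, ?_⟩
          rw [ghostEl_mul_edgeEl_self, pathEl_concat]
          simp only [mul_assoc, edgeEl_mul_range]
        · rw [ghostEl_mul_edgeEl_of_ne K s r hf, zero_mul, zero_mul]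
          exact zero_mem _
    | zero => simp
    | add y z _ _ hy hz => rw [mul_add, add_mul]; exact add_mem hy hz
    | smul k y _ hy =>
      rw [mul_smul_comm, smul_mul_assoc]; exact Submodule.smul_mem _ _ hy
  have := h _ hx
  rwa [mul_sub, ghostEl_mul_source, sub_mul, ghostEl_mul_edgeEl_self] at this

theorem exists_mul_mul_sub_mem_of_isPathFrom {v u : V} {es : List E} (h : IsPathFrom s r v u es) :
    ∀ {x : LPAU K s r}, x - vertexEl K s r v ∈ closedPathSpan K s r v →
      ∃ α β, α * x * β - vertexEl K s r u ∈ closedPathSpan K s r u := by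
  induction h with
  | nil v => exact fun hx => ⟨1, 1, by simpa using hx⟩
  | cons e _ ih =>
    intro x hx
    obtain ⟨α, β, h⟩ := ih (ghostEl_mul_mul_edgeEl_sub_mem K s r e hx)
    exact ⟨α * ghostEl K s r e, edgeEl K s r e * β, by simpa only [mul_assoc] using h⟩

theorem mul_ne_zero_of_sub_mem {u : V} {x y : LPAU K s r}
    (hx : x - vertexEl K s r u ∈ closedPathSpan K s r u)
    (hy : y - vertexEl K s r u ∈ closedPathSpan K s r u) : x * y ≠ 0 := by
  obtain ⟨ρ, hv, he⟩ := exists_graded_representation K s r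
  have hpath (p : List E) (f) (hf : ∀ x : V × (E ⊕ ℕ) × ℤ, x.2.2 < 0 → f x = 0) :
      ∀ x, x.2.2 < 0 → ρ (pathEl K s r p) f x = 0 := by
    induction p with
    | nil => simpa using hf
    | cons e p ih =>
      intro x hx
      rw [pathEl_cons, map_mul, Module.End.mul_apply]
      exact he e _ 0 ih x (by omega)
  have hP : ∀ z ∈ closedPathSpan K s r u, ∀ f, (∀ x, x.2.2 < 0 → f x = 0) →
      ∀ x, x.2.2 < 1 → ρ z f x = 0 := by
    intro z hz f hf
    induction hz using Submodule.span_induction with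
    | mem z h =>
      obtain ⟨p, hp, rfl⟩ := h
      intro x hx
      obtain ⟨e, p, rfl⟩ := List.exists_cons_of_ne_nil hp
      rw [map_mul, Module.End.mul_apply, hv, pathEl_cons, mul_assoc, map_mul,
        Module.End.mul_apply, he e _ 0 _ x (by simpa using hx), ite_self]
      rw [map_mul, Module.End.mul_apply]
      refine hpath p _ fun x hx => ?_
      rw [hv, hf x hx, ite_self]
    | zero => simp
    | add y z _ _ hy hz => intro x hx; simp [hy x hx, hz x hx]
    | smul k y _ hy => intro x hx; simp [hy x hx]
  have hQ : ∀ z, z - vertexEl K s r u ∈ closedPathSpan K s r u →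
      ∀ f, (∀ x, x.2.2 < 0 → f x = 0) →
        (∀ x, x.2.2 < 0 → ρ z f x = 0) ∧
          ρ z f (u, Sum.inr 0, 0) = f (u, Sum.inr 0, 0) := by
    intro z hz f hf
    have h := hP _ hz f hf
    simp only [map_sub, LinearMap.sub_apply, Pi.sub_apply, hv] at h
    refine ⟨fun x hx => ?_, ?_⟩
    · simpa [hf x hx] using h x (by omega)
    · simpa [sub_eq_zero] using h (u, Sum.inr 0, 0) (by simp)
  intro h0
  let f : V × (E ⊕ ℕ) × ℤ → K := fun x => if x.2.2 < 0 then 0 else 1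
  have h1 := hQ y hy f fun x hx => by simp [f, hx]
  have h2 := (hQ x hx _ h1.1).2
  rw [h1.2, ← Module.End.mul_apply, ← map_mul, h0] at h2
  simp [f] at h2

theorem ne_zero_of_sub_mem {u : V} {x : LPAU K s r}
    (hx : x - vertexEl K s r u ∈ closedPathSpan K s r u) : x ≠ 0 :=
  left_ne_zero_of_mul (mul_ne_zero_of_sub_mem K s r hx hx)

theorem vertexEl_ne_zero (u : V) : vertexEl K s r u ≠ 0 :=
  ne_zero_of_sub_mem K s r (by simp : _ - vertexEl K s r u ∈ closedPathSpan K s r u)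

end Unipotent

section Reduction

/-- The span of the paths of length at most `n` ending at `v`. -/
def pathBounded (v : V) (n : ℕ) : Submodule K (LPAU K s r) :=
  Submodule.span K {x | ∃ p, p.length ≤ n ∧ x = pathEl K s r p * vertexEl K s r v}

theorem pathBounded_mono (v : V) {m n : ℕ} (h : m ≤ n) :
    pathBounded K s r v m ≤ pathBounded K s r v n := by
  refine Submodule.span_mono ?_
  rintro _ ⟨p, hp, rfl⟩
  exact ⟨p, hp.trans h, rfl⟩

theorem exists_pathBounded_of_ghostBounded_zero {x : LPAU K s r} (hx : x ∈ ghostBounded K s r 0)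
    (v : V) : ∃ n, x * vertexEl K s r v ∈ pathBounded K s r v n := by
  induction hx using Submodule.span_induction with
  | mem x h =>
    obtain ⟨p, u, q, hq, rfl⟩ := h
    obtain rfl := List.length_eq_zero_iff.1 (Nat.le_zero.1 hq)
    refine ⟨p.length, ?_⟩
    rw [ghostPathEl_nil, mul_one, mul_assoc]
    by_cases h : u = v
    · subst h
      rw [vertexEl_mul_self]
      exact Submodule.subset_span ⟨p, le_rfl, rfl⟩
    · rw [vertexEl_mul_of_ne K s r h, mul_zero]
      exact zero_mem _
  | zero => exact ⟨0, by simp⟩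
  | add x y _ _ hx hy =>
    obtain ⟨m, hm⟩ := hx
    obtain ⟨n, hn⟩ := hy
    rw [add_mul]
    exact ⟨max m n, add_mem (pathBounded_mono K s r v (le_max_left _ _) hm)
      (pathBounded_mono K s r v (le_max_right _ _) hn)⟩
  | smul k x _ hx =>
    obtain ⟨m, hm⟩ := hx
    rw [smul_mul_assoc]
    exact ⟨m, Submodule.smul_mem _ _ hm⟩

/-- An element of `pathBounded v n` is a multiple of `v` plus a combination of paths of
positive length. -/
theorem pathBounded_decomposition {v : V} {n : ℕ} {x : LPAU K s r}
    (hx : x ∈ pathBounded K s r v n) : ∃ (k : K) (y : LPAU K s r),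
      x = k • vertexEl K s r v + y ∧ vertexEl K s r v * y ∈ closedPathSpan K s r v ∧
      (∀ e, ghostEl K s r e * y ∈ pathBounded K s r v (n - 1)) ∧ (n = 0 → y = 0) ∧
      ∃ F : Finset E, ∀ F', F ⊆ F' → y = ∑ e ∈ F', edgeEl K s r e * (ghostEl K s r e * y) := by
  classical
  induction hx using Submodule.span_induction with
  | mem x h =>
    obtain ⟨p, hp, rfl⟩ := h
    cases p with
    | nil => exact ⟨1, 0, by simp, by simp, by simp, by simp, ∅, by simp⟩
    | cons e p =>
      rw [List.length_cons] at hp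
      refine ⟨0, pathEl K s r (e :: p) * vertexEl K s r v, by simp,
        Submodule.subset_span ⟨_, by simp, rfl⟩, fun f => ?_, by omega, {e}, fun F' hF' => ?_⟩
      · rw [pathEl_cons, mul_assoc, ← mul_assoc]
        by_cases hf : f = e
        · subst hf
          rw [ghostEl_mul_edgeEl_self]
          rcases vertexEl_mul_pathEl_mul K s r (r f) p v with h | h
          · rw [h]; exact Submodule.subset_span ⟨p, by omega, rfl⟩
          · rw [h]; exact zero_mem _
        · rw [ghostEl_mul_edgeEl_of_ne K s r hf, zero_mul]; exact zero_mem _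
      · rw [Finset.sum_eq_single e]
        · rw [pathEl_cons, mul_assoc, ← mul_assoc (ghostEl K s r e), ghostEl_mul_edgeEl_self,
            ← mul_assoc (edgeEl K s r e) (vertexEl K s r _), edgeEl_mul_range]
        · intro f _ hf
          rw [pathEl_cons, mul_assoc, ← mul_assoc (ghostEl K s r f),
            ghostEl_mul_edgeEl_of_ne K s r hf, zero_mul, mul_zero]
        · exact fun h => (h (hF' (Finset.mem_singleton_self e))).elim
  | zero => exact ⟨0, 0, by simp, by simp, by simp, by simp, ∅, by simp⟩
  | add x x' _ _ hx hx' =>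
    obtain ⟨k, y, rfl, h1, h2, h3, F, hF⟩ := hx
    obtain ⟨k', y', rfl, h1', h2', h3', F₁, hF₁⟩ := hx'
    refine ⟨k + k', y + y', by rw [add_smul]; abel, ?_, fun e => ?_,
      fun h => by rw [h3 h, h3' h, add_zero], F ∪ F₁, fun F' hF' => ?_⟩
    · rw [mul_add]; exact add_mem h1 h1'
    · rw [mul_add]; exact add_mem (h2 e) (h2' e)
    · simp only [mul_add, Finset.sum_add_distrib]
      rw [← hF F' (Finset.union_subset_left hF'), ← hF₁ F' (Finset.union_subset_right hF')]
  | smul c x _ hx =>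
    obtain ⟨k, y, rfl, h1, h2, h3, F, hF⟩ := hx
    refine ⟨c * k, c • y, by rw [smul_add, mul_smul], ?_, fun e => ?_,
      fun h => by rw [h3 h, smul_zero], F, fun F' hF' => ?_⟩
    · rw [mul_smul_comm]; exact Submodule.smul_mem _ _ h1
    · rw [mul_smul_comm]; exact Submodule.smul_mem _ _ (h2 e)
    · simp only [mul_smul_comm, ← Finset.smul_sum]
      rw [← hF F' hF']

theorem exists_mul_sub_mem_of_pathBounded {v : V} {n : ℕ} : ∀ {x : LPAU K s r},
    x ∈ pathBounded K s r v n → x ≠ 0 →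
      ∃ α, α * x - vertexEl K s r v ∈ closedPathSpan K s r v := by
  induction n with
  | zero =>
    intro x hx h0
    obtain ⟨k, y, rfl, -, -, hy, -⟩ := pathBounded_decomposition K s r hx
    rw [hy rfl, add_zero] at h0 ⊢
    have hk : k ≠ 0 := fun h => h0 (by rw [h, zero_smul])
    exact ⟨k⁻¹ • 1, by simp [smul_smul, hk]⟩
  | succ n ih =>
    intro x hx h0
    obtain ⟨k, y, rfl, h1, h2, -, F, hF⟩ := pathBounded_decomposition K s r hx
    by_cases hk : k = 0
    · subst hk
      rw [zero_smul, zero_add] at h0 ⊢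
      obtain ⟨e, he⟩ : ∃ e, ghostEl K s r e * y ≠ 0 := by
        by_contra! h
        exact h0 (by rw [hF F subset_rfl]; simp [h])
      obtain ⟨α, hα⟩ := ih (h2 e) he
      exact ⟨α * ghostEl K s r e, by rwa [mul_assoc]⟩
    · refine ⟨k⁻¹ • vertexEl K s r v, ?_⟩
      rw [smul_mul_assoc, mul_add, mul_smul_comm, vertexEl_mul_self, smul_add, smul_smul,
        inv_mul_cancel₀ hk, one_smul, add_sub_cancel_left]
      exact Submodule.smul_mem _ _ h1

/-- Right multiplication by an edge is injective on real paths ending at its source. -/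
theorem mul_edgeEl_ne_zero {x : LPAU K s r} {e : E} (hx : x ∈ ghostBounded K s r 0)
    (h0 : x * vertexEl K s r (s e) ≠ 0) : x * edgeEl K s r e ≠ 0 := by
  obtain ⟨n, hn⟩ := exists_pathBounded_of_ghostBounded_zero K s r hx (s e)
  obtain ⟨α, hα⟩ := exists_mul_sub_mem_of_pathBounded K s r hn h0
  have := ne_zero_of_sub_mem K s r (ghostEl_mul_mul_edgeEl_sub_mem K s r e hα)
  intro h
  apply this
  simp only [mul_assoc, source_mul_edgeEl, h, mul_zero]

theorem mul_edgeEl_mem_ghostBounded {n : ℕ} {x : LPAU K s r} (hx : x ∈ ghostBounded K s r (n + 1))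
    (e : E) : x * edgeEl K s r e ∈ ghostBounded K s r n := by
  induction hx using Submodule.span_induction with
  | mem x h =>
    obtain ⟨p, u, q, hq, rfl⟩ := h
    cases q with
    | nil =>
      rw [ghostPathEl_nil, mul_one, mul_assoc]
      by_cases h : u = s e
      · subst h
        have := monomial_mem_ghostBounded K s r (p ++ [e]) (r e) (q := []) (Nat.zero_le n)
        rw [pathEl_concat, mul_assoc (pathEl K s r p), edgeEl_mul_range, ghostPathEl_nil,
          mul_one] at this
        rwa [source_mul_edgeEl]
      · rw [vertexEl_mul_edgeEl_of_ne K s r h, mul_zero]; exact zero_mem _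
    | cons f q =>
      rw [ghostPathEl_cons, mul_assoc, mul_assoc, mul_assoc (ghostPathEl K s r q)]
      by_cases h : f = e
      · subst h
        rw [ghostEl_mul_edgeEl_self, ← mul_assoc (vertexEl K s r u)]
        rcases mul_ghostPathEl_mul_vertexEl K s r u q (r f) with h | h
        · rw [h, ← mul_assoc]
          exact monomial_mem_ghostBounded K s r p u (by simpa using hq)
        · rw [h, mul_zero]; exact zero_mem _
      · rw [ghostEl_mul_edgeEl_of_ne K s r h, mul_zero, mul_zero, mul_zero]; exact zero_mem _
  | zero => simp
  | add x y _ _ hx hy => rw [add_mul]; exact add_mem hx hy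
  | smul k x _ hx => rw [smul_mul_assoc]; exact Submodule.smul_mem _ _ hx

theorem ghostBounded_decomposition {n : ℕ} {x : LPAU K s r} (hx : x ∈ ghostBounded K s r n) :
    ∃ b ∈ ghostBounded K s r 0, ∃ y, x = b + y ∧
      ∃ F : Finset E, ∀ F', F ⊆ F' → y = ∑ e ∈ F', y * edgeEl K s r e * ghostEl K s r e := by
  classical
  induction hx using Submodule.span_induction with
  | mem x h =>
    obtain ⟨p, u, q, -, rfl⟩ := h
    cases q with
    | nil =>
      exact ⟨_, monomial_mem_ghostBounded K s r p u (q := []) le_rfl, 0, by simp, ∅, by simp⟩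
    | cons e q =>
      refine ⟨0, zero_mem _, _, (zero_add _).symm, {e}, fun F' hF' => ?_⟩
      rw [Finset.sum_eq_single e]
      · simp only [ghostPathEl_cons, mul_assoc]
        rw [← mul_assoc (ghostEl K s r e), ghostEl_mul_edgeEl_self, range_mul_ghostEl]
      · intro f _ hf
        rw [ghostPathEl_cons]
        simp only [mul_assoc]
        rw [← mul_assoc (ghostEl K s r e), ghostEl_mul_edgeEl_of_ne K s r (Ne.symm hf)]
        simp
      · exact fun h => (h (hF' (Finset.mem_singleton_self e))).elim
  | zero => exact ⟨0, zero_mem _, 0, by simp, ∅, by simp⟩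
  | add x x' _ _ hx hx' =>
    obtain ⟨b, hb, y, rfl, F, hF⟩ := hx
    obtain ⟨b', hb', y', rfl, F₁, hF₁⟩ := hx'
    refine ⟨b + b', add_mem hb hb', y + y', by abel, F ∪ F₁, fun F' hF' => ?_⟩
    simp only [add_mul, Finset.sum_add_distrib]
    rw [← hF F' (Finset.union_subset_left hF'), ← hF₁ F' (Finset.union_subset_right hF')]
  | smul c x _ hx =>
    obtain ⟨b, hb, y, rfl, F, hF⟩ := hx
    refine ⟨c • b, Submodule.smul_mem _ _ hb, c • y, smul_add _ _ _, F, fun F' hF' => ?_⟩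
    simp only [smul_mul_assoc, ← Finset.smul_sum]
    rw [← hF F' hF']

theorem exists_mul_vertexEl_ne_zero {x : LPAU K s r} (hx : x ∈ monomialSpan K s r) (h0 : x ≠ 0) :
    ∃ v, x * vertexEl K s r v ≠ 0 := by
  classical
  obtain ⟨F, hF⟩ : ∃ F : Finset V, ∀ F', F ⊆ F' → x = ∑ v ∈ F', x * vertexEl K s r v := by
    clear h0
    induction hx using Submodule.span_induction with
    | mem x h =>
      obtain ⟨p, u, q, rfl⟩ := h
      obtain ⟨w, hw, hne⟩ : ∃ w,
          vertexEl K s r u * ghostPathEl K s r q * vertexEl K s r w =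
            vertexEl K s r u * ghostPathEl K s r q ∧
          ∀ v, v ≠ w → vertexEl K s r u * ghostPathEl K s r q * vertexEl K s r v = 0 := by
        cases q with
        | nil =>
          refine ⟨u, by simp [vertexEl_mul_self], fun v hv => ?_⟩
          simp [vertexEl_mul_of_ne K s r hv.symm]
        | cons e q =>
          refine ⟨s e, by simp only [ghostPathEl_cons, mul_assoc, ghostEl_mul_source],
            fun v hv => ?_⟩
          simp [ghostPathEl_cons, mul_assoc, ghostEl_mul_vertexEl_of_ne K s r hv.symm]
      refine ⟨{w}, fun F' hF' => ?_⟩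
      simp only [mul_assoc] at hw hne ⊢
      rw [Finset.sum_eq_single w, hw]
      · intro v _ hv; rw [hne v hv, mul_zero]
      · exact fun h => (h (hF' (Finset.mem_singleton_self w))).elim
    | zero => exact ⟨∅, by simp⟩
    | add x y _ _ hx hy =>
      obtain ⟨F, hF⟩ := hx
      obtain ⟨F₁, hF₁⟩ := hy
      refine ⟨F ∪ F₁, fun F' hF' => ?_⟩
      simp only [add_mul, Finset.sum_add_distrib]
      rw [← hF F' (Finset.union_subset_left hF'), ← hF₁ F' (Finset.union_subset_right hF')]
    | smul c x _ hx =>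
      obtain ⟨F, hF⟩ := hx
      refine ⟨F, fun F' hF' => ?_⟩
      simp only [smul_mul_assoc, ← Finset.smul_sum]
      rw [← hF F' hF']
  by_contra! h
  exact h0 (by rw [hF F subset_rfl]; simp [h])

/-- If every edge annihilates `x` on the right, then `x` lives at sinks, where it is a
combination of real paths. -/
theorem exists_eq_mul_vertexEl_of_mul_edgeEl_eq_zero {n : ℕ} {x : LPAU K s r}
    (hx : x ∈ ghostBounded K s r n) (he : ∀ e, x * edgeEl K s r e = 0) {v : V}
    (hv : x * vertexEl K s r v ≠ 0) :
    ∃ b ∈ ghostBounded K s r 0, x * vertexEl K s r v = b * vertexEl K s r v := by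
  obtain ⟨b, hb, y, rfl, F, hF⟩ := ghostBounded_decomposition K s r hx
  refine ⟨b, hb, ?_⟩
  have hye (e : E) : y * edgeEl K s r e = -(b * edgeEl K s r e) := by
    rw [eq_neg_iff_add_eq_zero, add_comm, ← add_mul, he]
  suffices h : ∀ e, s e = v → b * edgeEl K s r e = 0 by
    have : y * vertexEl K s r v = 0 := by
      rw [hF F subset_rfl, Finset.sum_mul]
      refine Finset.sum_eq_zero fun e _ => ?_
      by_cases hs : s e = v
      · rw [hye, h e hs]; simp
      · rw [mul_assoc, ghostEl_mul_vertexEl_of_ne K s r hs, mul_zero]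
    rw [add_mul, this, add_zero]
  rintro e₀ rfl
  by_cases hfin : {e : E | s e = s e₀}.Finite
  · refine (hv ?_).elim
    rw [vertexEl_eq_sum K s r (s e₀) hfin ⟨e₀, rfl⟩, Finset.mul_sum]
    refine Finset.sum_eq_zero fun e _ => ?_
    rw [← mul_assoc, he, zero_mul]
  · obtain ⟨e, hes, heF⟩ := Set.Infinite.exists_notMem_finset hfin F
    have hy0 : y * edgeEl K s r e = 0 := by
      rw [hF F subset_rfl, Finset.sum_mul]
      refine Finset.sum_eq_zero fun f hf => ?_
      rw [mul_assoc, ghostEl_mul_edgeEl_of_ne K s r (ne_of_mem_of_not_mem hf heF), mul_zero]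
    have hb0 : b * vertexEl K s r (s e) = 0 := by
      by_contra h
      refine mul_edgeEl_ne_zero K s r hb h ?_
      rw [← neg_eq_zero, ← hye, hy0]
    rw [← source_mul_edgeEl, ← hes, ← mul_assoc, hb0, zero_mul]

/-- Every nonzero element can be reduced to a vertex plus closed paths of positive length. -/
theorem exists_mul_mul_sub_mem_of_ghostBounded {n : ℕ} : ∀ {x : LPAU K s r},
    x ∈ ghostBounded K s r n → x ≠ 0 →
      ∃ α β v, α * x * β - vertexEl K s r v ∈ closedPathSpan K s r v := by
  have hspan {m : ℕ} {x : LPAU K s r} (hx : x ∈ ghostBounded K s r m) :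
      x ∈ monomialSpan K s r :=
    Submodule.span_mono (by rintro _ ⟨p, u, q, -, rfl⟩; exact ⟨p, u, q, rfl⟩) hx
  have base {b : LPAU K s r} {v : V} (hb : b ∈ ghostBounded K s r 0)
      (h0 : b * vertexEl K s r v ≠ 0) :
      ∃ α, α * (b * vertexEl K s r v) - vertexEl K s r v ∈ closedPathSpan K s r v := by
    obtain ⟨m, hm⟩ := exists_pathBounded_of_ghostBounded_zero K s r hb v
    exact exists_mul_sub_mem_of_pathBounded K s r hm h0
  induction n with
  | zero =>
    intro x hx h0
    obtain ⟨v, hv⟩ := exists_mul_vertexEl_ne_zero K s r (hspan hx) h0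
    obtain ⟨α, hα⟩ := base hx hv
    exact ⟨α, _, v, by rwa [mul_assoc]⟩
  | succ n ih =>
    intro x hx h0
    by_cases h : ∃ e, x * edgeEl K s r e ≠ 0
    · obtain ⟨e, he⟩ := h
      obtain ⟨α, β, v, h⟩ := ih (mul_edgeEl_mem_ghostBounded K s r hx e) he
      exact ⟨α, edgeEl K s r e * β, v, by simpa only [mul_assoc] using h⟩
    · push Not at h
      obtain ⟨v, hv⟩ := exists_mul_vertexEl_ne_zero K s r (hspan hx) h0
      obtain ⟨b, hb, hxb⟩ := exists_eq_mul_vertexEl_of_mul_edgeEl_eq_zero K s r hx h hv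
      obtain ⟨α, hα⟩ := base hb (hxb ▸ hv)
      exact ⟨α, vertexEl K s r v, v, by rwa [mul_assoc, hxb]⟩

theorem exists_mul_mul_sub_mem {x : LPAU K s r} (hx : x ∈ lpa K s r) (h0 : x ≠ 0) :
    ∃ α β v, α * x * β - vertexEl K s r v ∈ closedPathSpan K s r v := by
  obtain ⟨n, hn⟩ := exists_mem_ghostBounded K s r (lpa_le_monomialSpan K s r hx)
  exact exists_mul_mul_sub_mem_of_ghostBounded K s r hn h0

end Reduction

section Ideals

theorem exists_geq_of_mul_mul_ne_zero {v w : V} {x : LPAU K s r} (hx : x ∈ lpa K s r)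
    (h0 : vertexEl K s r v * x * vertexEl K s r w ≠ 0) :
    ∃ u, Geq s r v u ∧ Geq s r w u := by
  by_contra! h
  apply h0
  clear h0
  replace hx := lpa_le_monomialSpan K s r hx
  induction hx using Submodule.span_induction with
  | mem x hx =>
    obtain ⟨p, u, q, rfl⟩ := hx
    by_cases hv : Geq s r v u
    · have := mt (geq_of_ghostPathEl_mul_vertexEl_ne_zero K s r (q := q)) (h u hv)
      rw [not_not] at this
      simp only [mul_assoc] at this ⊢
      simp [this]
    · have := mt (geq_of_vertexEl_mul_pathEl_ne_zero K s r (p := p)) hv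
      rw [not_not] at this
      rw [← mul_assoc (vertexEl K s r v), this, zero_mul, zero_mul]
  | zero => simp
  | add x y _ _ hx hy => rw [mul_add, add_mul, hx, hy, add_zero]
  | smul k x _ hx => rw [mul_smul_comm, smul_mul_assoc, hx, smul_zero]

/-- In a prime ring, `a R b = 0` and `a b = 0` force `a = 0` or `b = 0`. -/
theorem eq_zero_or_eq_zero_of_forall_mul_mul_eq_zero {R : Type} [NonUnitalRing R]
    (hprime : ∀ I J : Set R, IsTwoSidedIdealSet I → IsTwoSidedIdealSet J →
      (∀ a ∈ I, ∀ b ∈ J, a * b = 0) → I = {0} ∨ J = {0}) {a b : R} (hab : a * b = 0)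
    (haxb : ∀ x, a * x * b = 0) : a = 0 ∨ b = 0 := by
  let J : Set R := {y | a * y = 0 ∧ ∀ x, a * x * y = 0}
  let I : Set R := {x | ∀ y ∈ J, x * y = 0 ∧ ∀ z, x * z * y = 0}
  have hJ : IsTwoSidedIdealSet J := by
    refine ⟨by simp [J], fun y hy z hz => ?_, fun y hy => ?_, fun x y hy => ⟨?_, ?_⟩⟩
    · exact ⟨by rw [mul_add, hy.1, hz.1, add_zero], fun x => by
        rw [mul_add, hy.2, hz.2, add_zero]⟩
    · exact ⟨by rw [mul_neg, hy.1, neg_zero], fun x => by rw [mul_neg, hy.2, neg_zero]⟩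
    · exact ⟨by rw [← mul_assoc, hy.2], fun z => by
        rw [← mul_assoc, mul_assoc a z x, hy.2]⟩
    · exact ⟨by rw [← mul_assoc, hy.1, zero_mul], fun z => by
        rw [← mul_assoc, hy.2, zero_mul]⟩
  have hI : IsTwoSidedIdealSet I := by
    refine ⟨fun y _ => by simp, fun x hx z hz y hy => ?_, fun x hx y hy => ?_,
      fun z x hx => ⟨fun y hy => ?_, fun y hy => ?_⟩⟩
    · exact ⟨by rw [add_mul, (hx y hy).1, (hz y hy).1, add_zero], fun t => by
        rw [add_mul, add_mul, (hx y hy).2, (hz y hy).2, add_zero]⟩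
    · exact ⟨by rw [neg_mul, (hx y hy).1, neg_zero], fun t => by
        rw [neg_mul, neg_mul, (hx y hy).2, neg_zero]⟩
    · exact ⟨by rw [mul_assoc, (hx y hy).1, mul_zero], fun t => by
        rw [mul_assoc z, mul_assoc z, (hx y hy).2, mul_zero]⟩
    · exact ⟨(hx y hy).2 z, fun t => by rw [mul_assoc x, (hx y hy).2]⟩
  have ha : a ∈ I := fun y hy => hy
  have hb : b ∈ J := ⟨hab, haxb⟩
  rcases hprime I J hI hJ fun x hx y hy => (hx y hy).1 with h | h
  · left; simpa [h] using ha
  · right; simpa [h] using hb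

/-- If an ideal contains a nonzero element, then there is a vertex `v` such that for every `u` with
`v ≥ u` the ideal contains an element of the form `u` plus closed paths of positive length. -/
theorem IsTwoSidedIdealSet.exists_sub_mem {I : Set ↥(lpa K s r)} (hI : IsTwoSidedIdealSet I)
    {a : ↥(lpa K s r)} (ha : a ∈ I) (h0 : a ≠ 0) : ∃ v, ∀ u, Geq s r v u →
      ∃ x ∈ I, (x : LPAU K s r) - vertexEl K s r u ∈ closedPathSpan K s r u := by
  obtain ⟨α, β, v, h⟩ := exists_mul_mul_sub_mem K s r a.2 (by simpa using h0)
  refine ⟨v, fun u ⟨es, hes⟩ => ?_⟩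
  obtain ⟨α', β', h'⟩ := exists_mul_mul_sub_mem_of_isPathFrom K s r hes h
  have hu : vertexEl K s r u ∈ lpa K s r := gen_mem_lpa K s r (.vertex u)
  let l : ↥(lpa K s r) := ⟨vertexEl K s r u * (α' * α), (mul_mem_lpa K s r _ hu).2⟩
  let t : ↥(lpa K s r) := ⟨β * β' * vertexEl K s r u, (mul_mem_lpa K s r _ hu).1⟩
  refine ⟨l * a * t, (hI.2.2.2 t _ (hI.2.2.2 l a ha).1).2, ?_⟩
  have hz := vertexEl_mul_of_sub_mem K s r h'
  have heq : ((l * a * t : ↥(lpa K s r)) : LPAU K s r) = α' * (α * a * β) * β' := by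
    calc ((l * a * t : ↥(lpa K s r)) : LPAU K s r)
        = vertexEl K s r u * (α' * (α * a * β) * β') * vertexEl K s r u := by
          simp only [l, t, NonUnitalSubalgebra.coe_mul, mul_assoc]
      _ = _ := by rw [hz.1, hz.2]
  rwa [heq]

theorem IsTwoSidedIdealSet.exists_ne_zero {R : Type} [NonUnitalRing R] {I : Set R}
    (hI : IsTwoSidedIdealSet I) (h : I ≠ {0}) : ∃ a ∈ I, a ≠ 0 := by
  by_contra! h'
  exact h (Set.eq_singleton_iff_unique_mem.2 ⟨hI.1, h'⟩)

end Ideals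

/-- For any graph `E` and field `K`, the Leavitt path algebra `L_K(E)` is a prime ring
(the product of two nonzero two-sided ideals is nonzero) if and only if `E` is downward
directed. -/
theorem prime_iff_downward_directed (K V E : Type) [Field K] (s r : E → V) :
    (∀ I J : Set ↥(lpa K s r), IsTwoSidedIdealSet I → IsTwoSidedIdealSet J →
        (∀ a ∈ I, ∀ b ∈ J, a * b = 0) → I = {0} ∨ J = {0}) ↔
      (∀ v w : V, ∃ u : V, Geq s r v u ∧ Geq s r w u) := by
  constructor
  · intro hprime v w
    by_contra h
    have hvw : v ≠ w := by
      rintro rfl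
      exact h ⟨v, ⟨[], .nil v⟩, ⟨[], .nil v⟩⟩
    have hmul : vertexIn K s r v * vertexIn K s r w = 0 :=
      Subtype.ext (vertexEl_mul_of_ne K s r hvw)
    rcases eq_zero_or_eq_zero_of_forall_mul_mul_eq_zero hprime hmul fun x => by
        by_contra h0
        exact h (exists_geq_of_mul_mul_ne_zero K s r x.2 fun h1 => h0 (Subtype.ext h1)) with h0 | h0
    · exact vertexEl_ne_zero K s r v (congrArg Subtype.val h0)
    · exact vertexEl_ne_zero K s r w (congrArg Subtype.val h0)
  · intro hdir I J hI hJ hIJ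
    by_contra! h
    obtain ⟨a, ha, ha0⟩ := hI.exists_ne_zero h.1
    obtain ⟨b, hb, hb0⟩ := hJ.exists_ne_zero h.2
    obtain ⟨v, hv⟩ := hI.exists_sub_mem K s r ha ha0
    obtain ⟨w, hw⟩ := hJ.exists_sub_mem K s r hb hb0
    obtain ⟨u, hvu, hwu⟩ := hdir v w
    obtain ⟨x, hx, hxu⟩ := hv u hvu
    obtain ⟨y, hy, hyu⟩ := hw u hwu
    exact mul_ne_zero_of_sub_mem K s r hxu hyu (congrArg Subtype.val (hIJ x hx y hy))
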